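/- Let A be a finite set of real numbers with A ⊆ [1,∞) and let Z = ⨁_{p∈A} ℓ_p. If (x_j)_{j∈J} is an unconditional basis of Z, then there is a partition (J_p)_{p∈A} of J such that for every p ∈ A the closed linear span of {x_j : j ∈ J_p} in Z is isomorphic (linearly homeomorphic) to ℓ_p. (This is the case A ⊆ [1,∞) of the paper's Main Theorem.) -/

import Mathlib

open scoped ENNReal

noncomputable section

/-- The sequence space `ℓ_p` of real sequences, for a real exponent `p`. -/
abbrev ellp (p : ℝ) : Type := lp (fun _ : ℕ => ℝ) (ENNReal.ofReal p)

instance (p : {q : ℝ // 1 ≤ q}) : Fact ((1 : ℝ≥0∞) ≤ ENNReal.ofReal p.1) :=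
  ⟨ENNReal.one_le_ofReal.mpr p.2⟩

section
structure UB {Y : Type*} [NormedAddCommGroup Y] [NormedSpace ℝ Y] {J : Type*}
    (x : J → Y) (c : J → Y →L[ℝ] ℝ) (K : ℝ) : Prop where
  bi_self : ∀ j, c j (x j) = 1
  bi_ne : ∀ i j, i ≠ j → c i (x j) = 0
  hs : ∀ f, HasSum (fun j => c j f • x j) f
  K_nonneg : 0 ≤ K
  bd : ∀ (F : Finset J) (s : J → ℝ) (M : ℝ), 0 ≤ M → (∀ j ∈ F, |s j| ≤ M) →
    ∀ f, ‖∑ j ∈ F, (s j * c j f) • x j‖ ≤ M * K * ‖f‖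

lemma bdd_partial {Y : Type*} [NormedAddCommGroup Y] {J : Type*} {g : J → Y} {y : Y}
    (h : HasSum g y) : ∃ C, ∀ F : Finset J, ‖∑ j ∈ F, g j‖ ≤ C := by
  classical
  have h1 : CauchySeq (fun F : Finset J => ∑ j ∈ F, g j) := HasSum.summable h |>.hasSum.cauchySeq
  rw [cauchySeq_finset_iff_vanishing_norm] at h1
  obtain ⟨s, hs⟩ := h1 1 one_pos
  refine ⟨∑ j ∈ s, ‖g j‖ + 1, fun F => ?_⟩
  rw [← Finset.sum_inter_add_sum_sdiff F s]
  refine (norm_add_le _ _).trans (add_le_add ?_ ?_)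
  · refine (norm_sum_le _ _).trans ?_
    exact Finset.sum_le_sum_of_subset_of_nonneg Finset.inter_subset_right (fun _ _ _ => norm_nonneg _)
  · exact (hs _ Finset.sdiff_disjoint).le

/-- Multiplier bound from partial sums bound. -/
lemma mult_bound {Y : Type*} [NormedAddCommGroup Y] [NormedSpace ℝ Y] {J : Type*}
    (g : J → Y) (C : ℝ) (h : ∀ F : Finset J, ‖∑ j ∈ F, g j‖ ≤ C)
    (F : Finset J) (s : J → ℝ) (M : ℝ) (hs : ∀ j ∈ F, |s j| ≤ M) (hM : 0 ≤ M) :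
    ‖∑ j ∈ F, s j • g j‖ ≤ M * (2 * C) := by
  classical
  obtain ⟨φ, hφ, hφ2⟩ := exists_dual_vector'' ℝ (∑ j ∈ F, s j • g j)
  have h3 : ∀ G : Finset J, |∑ j ∈ G, φ (g j)| ≤ C := by
    intro G
    rw [← map_sum, ← Real.norm_eq_abs]
    refine (φ.le_opNorm _).trans ?_
    calc ‖φ‖ * ‖∑ j ∈ G, g j‖ ≤ 1 * ‖∑ j ∈ G, g j‖ := by gcongr
      _ ≤ C := by rw [one_mul]; exact h G
  have h2 : ∑ j ∈ F, |φ (g j)| ≤ 2 * C := by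
    rw [← Finset.sum_filter_add_sum_filter_not F (fun j => 0 ≤ φ (g j))]
    have e1 : ∑ j ∈ F with 0 ≤ φ (g j), |φ (g j)| = ∑ j ∈ F with 0 ≤ φ (g j), φ (g j) :=
      Finset.sum_congr rfl fun j hj => abs_of_nonneg (Finset.mem_filter.1 hj).2
    have e2 : ∑ j ∈ F with ¬ 0 ≤ φ (g j), |φ (g j)| = - ∑ j ∈ F with ¬ 0 ≤ φ (g j), φ (g j) := by
      rw [← Finset.sum_neg_distrib]
      exact Finset.sum_congr rfl fun j hj => abs_of_neg (not_le.1 (Finset.mem_filter.1 hj).2)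
    rw [e1, e2]
    have a1 := h3 (F.filter fun j => 0 ≤ φ (g j))
    have a2 := h3 (F.filter fun j => ¬ 0 ≤ φ (g j))
    have := abs_le.1 a1
    have := abs_le.1 a2
    linarith
  have h4 : φ (∑ j ∈ F, s j • g j) = ‖∑ j ∈ F, s j • g j‖ := by simpa using hφ2
  rw [← h4, map_sum]
  calc ∑ j ∈ F, φ (s j • g j) ≤ ∑ j ∈ F, M * |φ (g j)| := by
        refine Finset.sum_le_sum fun j hj => ?_
        rw [map_smul, smul_eq_mul]
        refine (le_abs_self _).trans ?_
        rw [abs_mul]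
        exact mul_le_mul_of_nonneg_right (hs j hj) (abs_nonneg _)
    _ = M * ∑ j ∈ F, |φ (g j)| := by rw [Finset.mul_sum]
    _ ≤ _ := by gcongr

theorem exists_UB {Y : Type*} [NormedAddCommGroup Y] [NormedSpace ℝ Y] [CompleteSpace Y]
    {J : Type*} (x : J → Y) (hx : ∀ f : Y, ∃! a : J → ℝ, HasSum (fun j => a j • x j) f) :
    ∃ (c : J → Y →L[ℝ] ℝ) (K : ℝ), UB x c K := by
  classical
  choose a ha hu using hx
  simp only at ha hu
  have x_ne : ∀ j, x j ≠ 0 := by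
    intro j hj
    have h1 := hu 0 (fun _ => 0) (by simp)
    have h2 := hu 0 (Pi.single j 1) (by
      have : (fun i => (Pi.single j (1:ℝ) : J → ℝ) i • x i) = fun _ => 0 := by
        funext i
        by_cases h : i = j
        · subst h; simp [hj]
        · simp [h]
      rw [this]; exact hasSum_zero)
    have := congrFun (h1.trans h2.symm) j
    simp at this
  have a_add : ∀ f g, a (f + g) = a f + a g := fun f g => (hu _ _ (by
    simpa [add_smul] using (ha f).add (ha g))).symm
  have a_smul : ∀ (r : ℝ) f, a (r • f) = r • a f := fun r f => (hu _ _ (by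
    simpa [mul_smul] using (ha f).const_smul r)).symm
  have a_x : ∀ j, a (x j) = Pi.single j 1 := fun j => (hu _ _ (by
    have := hasSum_ite_eq j (x j)
    convert this using 2 with i
    by_cases h : i = j
    · subst h; simp
    · simp [h])).symm
  -- partial sums map
  let T : Y →ₗ[ℝ] lp (fun _ : Finset J => Y) ∞ :=
    { toFun := fun f => ⟨fun F => ∑ j ∈ F, a f j • x j, by
        obtain ⟨C, hC⟩ := bdd_partial (ha f)
        exact memℓp_infty ⟨C, by rintro _ ⟨F, rfl⟩; exact hC F⟩⟩
      map_add' := by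
        intro f g; ext F
        simp [a_add, add_smul, Finset.sum_add_distrib]
        rfl
      map_smul' := by
        intro r f; ext F
        simp [a_smul, mul_smul, Finset.smul_sum] }
  have Tap : ∀ f F, (T f : Finset J → Y) F = ∑ j ∈ F, a f j • x j := fun f F => rfl
  have hT : Continuous T := by
    refine T.continuous_of_seq_closed_graph fun u f G hu1 hTu => ?_
    have hpt : ∀ F, Filter.Tendsto (fun n => ∑ j ∈ F, a (u n) j • x j) Filter.atTop (nhds (G F)) := by
      intro F
      exact ((lp.lipschitzWith_one_eval (E := fun _ : Finset J => Y) ∞ F).continuous.tendsto G).comp hTu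
    -- coefficients
    have hb : ∀ j, ∃ b : ℝ, G {j} = b • x j := by
      intro j
      have hcl : IsClosed (Submodule.span ℝ {x j} : Set Y) := Submodule.closed_of_finiteDimensional _
      have : G {j} ∈ (Submodule.span ℝ {x j} : Set Y) := by
        refine hcl.mem_of_tendsto (hpt {j}) (Filter.Eventually.of_forall fun n => ?_)
        simp only [Finset.sum_singleton]
        exact Submodule.smul_mem _ _ (Submodule.mem_span_singleton_self _)
      obtain ⟨b, hb⟩ := Submodule.mem_span_singleton.1 this
      exact ⟨b, hb.symm⟩
    choose b hb using hb
    have hGF : ∀ F, G F = ∑ j ∈ F, b j • x j := by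
      intro F
      refine tendsto_nhds_unique (hpt F) ?_
      refine tendsto_finsetSum _ fun j _ => ?_
      rw [← hb j]
      simpa using hpt {j}
    have hGs : HasSum (fun j => b j • x j) f := by
      rw [HasSum, SummationFilter.unconditional_filter]
      have hunif : TendstoUniformly (fun n F => ∑ j ∈ F, a (u n) j • x j)
          (fun F => ∑ j ∈ F, b j • x j) Filter.atTop := by
        rw [Metric.tendstoUniformly_iff]
        intro ε hε
        have := Metric.tendsto_atTop.1 hTu ε hε
        obtain ⟨N, hN⟩ := this
        filter_upwards [Filter.eventually_ge_atTop N] with n hn F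
        rw [← hGF, ← Tap, dist_comm]
        refine lt_of_le_of_lt ?_ (hN n hn)
        rw [dist_eq_norm, dist_eq_norm]
        exact lp.norm_apply_le_norm (by simp) (T (u n) - G) F
      refine hunif.tendstoUniformlyOnFilter.mono_right le_top |>.tendsto_of_eventually_tendsto
        (Filter.Eventually.of_forall fun n => ?_) hu1
      simpa [HasSum] using ha (u n)
    have : b = a f := hu f b hGs
    ext F
    rw [hGF, Tap, this]
  let Tc : Y →L[ℝ] lp (fun _ : Finset J => Y) ∞ := ⟨T, hT⟩
  have hTb : ∀ f F, ‖∑ j ∈ F, a f j • x j‖ ≤ ‖Tc‖ * ‖f‖ := fun f F =>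
    (lp.norm_apply_le_norm (by simp) (T f) F).trans (Tc.le_opNorm f)
  have hc : ∀ j f, |a f j| ≤ ‖Tc‖ / ‖x j‖ * ‖f‖ := by
    intro j f
    have := hTb f {j}
    rw [Finset.sum_singleton, norm_smul, Real.norm_eq_abs] at this
    have hp : 0 < ‖x j‖ := norm_pos_iff.2 (x_ne j)
    rw [div_mul_eq_mul_div, le_div_iff₀ hp]
    exact this
  let c : J → Y →L[ℝ] ℝ := fun j => LinearMap.mkContinuous
    { toFun := fun f => a f j
      map_add' := fun f g => by simp [a_add]
      map_smul' := fun r f => by simp [a_smul] } (‖Tc‖ / ‖x j‖) (hc j)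
  have hcap : ∀ j f, c j f = a f j := fun _ _ => rfl
  refine ⟨c, 2 * ‖Tc‖, ⟨?_, ?_, ?_, by positivity, ?_⟩⟩
  · intro j; simp [hcap, a_x]
  · intro i j hij; simp [hcap, a_x, hij]
  · intro f; exact ha f
  · intro F s M hM hs f
    have := mult_bound (fun j => a f j • x j) (‖Tc‖ * ‖f‖) (hTb f) F s M hs hM
    simp only [smul_smul] at this
    calc _ ≤ _ := this
      _ = _ := by ring

end

section
open Classical in
def sg {J : Type*} (t : Finset J) (j : J) : ℝ := if j ∈ t then 1 else -1

lemma abs_sg {J : Type*} (t : Finset J) (j : J) : |sg t j| = 1 := by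
  unfold sg; split_ifs <;> simp

lemma sg_mul_self {J : Type*} (t : Finset J) (j : J) : sg t j * sg t j = 1 := by
  unfold sg; split_ifs <;> simp

def av {J E : Type*} [AddCommGroup E] [Module ℝ E] (F : Finset J) (h : Finset J → E) : E :=
  ((2 : ℝ) ^ F.card)⁻¹ • ∑ t ∈ F.powerset, h t

section av
variable {J E : Type*} [AddCommGroup E] [Module ℝ E]

lemma av_congr (F : Finset J) {h h' : Finset J → E} (e : ∀ t, t ⊆ F → h t = h' t) :
    av F h = av F h' := by
  unfold av; congr 1
  exact Finset.sum_congr rfl fun t ht => e t (Finset.mem_powerset.1 ht)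

lemma av_const (F : Finset J) (y : E) : av F (fun _ => y) = y := by
  unfold av
  rw [Finset.sum_const, Finset.card_powerset, ← Nat.cast_smul_eq_nsmul ℝ, smul_smul]
  simp

lemma av_zero (F : Finset J) : av F (fun _ => (0 : E)) = 0 := av_const F 0

lemma av_add (F : Finset J) (h h' : Finset J → E) :
    av F (fun t => h t + h' t) = av F h + av F h' := by
  unfold av; rw [Finset.sum_add_distrib, smul_add]

lemma av_sum {ι : Type*} (F : Finset J) (s : Finset ι) (h : ι → Finset J → E) :
    av F (fun t => ∑ i ∈ s, h i t) = ∑ i ∈ s, av F (h i) := by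
  unfold av; rw [Finset.sum_comm, Finset.smul_sum]

lemma av_smul (F : Finset J) (r : ℝ) (h : Finset J → E) :
    av F (fun t => r • h t) = r • av F h := by
  unfold av; rw [← Finset.smul_sum, smul_comm]

lemma av_smul_const (F : Finset J) (h : Finset J → ℝ) (y : E) :
    av F (fun t => h t • y) = av F h • y := by
  unfold av; rw [← Finset.sum_smul, smul_smul, smul_eq_mul]

open Classical in
lemma av_insert (F : Finset J) (k : J) (hk : k ∉ F) (h : Finset J → E) :
    av (insert k F) h = (2 : ℝ)⁻¹ • (av F h + av F (fun t => h (insert k t))) := by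
  unfold av
  rw [Finset.card_insert_of_notMem hk, Finset.sum_powerset_insert hk, ← smul_add, smul_smul,
    pow_succ, mul_inv, mul_comm]

open Classical in
lemma av_toggle (F : Finset J) (k : J) (hk : k ∈ F) (h : Finset J → E)
    (hh : ∀ t, k ∉ t → h (insert k t) = h t) : av F (fun t => sg t k • h t) = 0 := by
  obtain ⟨F', hk', rfl⟩ : ∃ F', k ∉ F' ∧ insert k F' = F :=
    ⟨F.erase k, Finset.notMem_erase k F, Finset.insert_erase hk⟩
  rw [av_insert _ _ hk', ← av_add, av_congr F' (h' := fun _ => 0), av_zero, smul_zero]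
  intro t ht
  have : k ∉ t := fun h => hk' (ht h)
  simp [sg, this, hh t this]

open Classical in
lemma av_inter (E' F : Finset J) (hEF : E' ⊆ F) (h : Finset J → E) :
    av F (fun t => h (t ∩ E')) = av E' h := by
  suffices H : ∀ G : Finset J, Disjoint G E' → av (G ∪ E') (fun t => h (t ∩ E')) = av E' h by
    have := H (F \ E') Finset.sdiff_disjoint
    rwa [Finset.sdiff_union_of_subset hEF] at this
  intro G
  induction G using Finset.induction_on with
  | empty =>
    intro _
    rw [Finset.empty_union]
    exact av_congr _ fun t ht => by rw [Finset.inter_eq_left.2 ht]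
  | insert k G hk ih =>
    intro hd
    rw [Finset.disjoint_insert_left] at hd
    rw [Finset.insert_union, av_insert _ _ (by simp [hk, hd.1])]
    have : (fun t => h (insert k t ∩ E')) = fun t => h (t ∩ E') := by
      funext t; rw [Finset.insert_inter_of_notMem hd.1]
    rw [this, ih hd.2, ← two_smul ℝ, smul_smul]
    norm_num

lemma av_sg_sg (F : Finset J) (k l : J) (hk : k ∈ F) (hkl : k ≠ l) :
    av F (fun t => sg t k * sg t l) = 0 := by
  refine av_toggle F k hk (fun t => sg t l) fun t _ => ?_
  by_cases h : l ∈ t <;> simp [sg, h, Finset.mem_insert, hkl.symm]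

lemma av_mono (F : Finset J) {h h' : Finset J → ℝ} (e : ∀ t, t ⊆ F → h t ≤ h' t) :
    av F h ≤ av F h' := by
  unfold av
  rw [smul_eq_mul, smul_eq_mul]
  gcongr with t ht
  exact e t (Finset.mem_powerset.1 ht)

lemma av_nonneg (F : Finset J) {h : Finset J → ℝ} (e : ∀ t, t ⊆ F → 0 ≤ h t) :
    0 ≤ av F h := by
  rw [← av_zero F]; exact av_mono F e

lemma norm_av_le {E : Type*} [NormedAddCommGroup E] [NormedSpace ℝ E] (F : Finset J)
    (h : Finset J → E) : ‖av F h‖ ≤ av F (fun t => ‖h t‖) := by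
  unfold av
  rw [norm_smul, smul_eq_mul, Real.norm_eq_abs, abs_of_nonneg (by positivity)]
  gcongr
  exact norm_sum_le _ _

lemma av_rpow_le (F : Finset J) (h : Finset J → ℝ) (hh : ∀ t, 0 ≤ h t) (r : ℝ) (hr : 1 ≤ r) :
    (av F h) ^ r ≤ av F (fun t => h t ^ r) := by
  have := Real.rpow_arith_mean_le_arith_mean_rpow F.powerset (fun _ => ((2 : ℝ) ^ F.card)⁻¹) h
    (fun _ _ => by positivity) (by simp) (fun t _ => hh t) hr
  unfold av
  simpa [Finset.mul_sum] using this

lemma av_contract (r : ℝ) (hr : 1 ≤ r) (a : J → ℝ) (E' F : Finset J) (hEF : E' ⊆ F) :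
    av E' (fun t => |∑ j ∈ E', sg t j * a j| ^ r) ≤ av F (fun t => |∑ j ∈ F, sg t j * a j| ^ r) := by
  classical
  suffices H : ∀ G : Finset J, Disjoint G E' →
      av E' (fun t => |∑ j ∈ E', sg t j * a j| ^ r) ≤
        av (G ∪ E') (fun t => |∑ j ∈ G ∪ E', sg t j * a j| ^ r) by
    have := H (F \ E') Finset.sdiff_disjoint
    rwa [Finset.sdiff_union_of_subset hEF] at this
  intro G
  induction G using Finset.induction_on with
  | empty => intro _; rw [Finset.empty_union]
  | insert k G hk ih =>
    intro hd
    rw [Finset.disjoint_insert_left] at hd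
    have hk' : k ∉ G ∪ E' := by simp [hk, hd.1]
    refine (ih hd.2).trans ?_
    rw [Finset.insert_union, av_insert _ _ hk', ← av_add, ← av_smul]
    refine av_mono _ fun t ht => ?_
    have hkt : k ∉ t := fun h => hk' (ht h)
    rw [Finset.sum_insert hk', Finset.sum_insert hk']
    have e1 : ∑ j ∈ G ∪ E', sg (insert k t) j * a j = ∑ j ∈ G ∪ E', sg t j * a j := by
      refine Finset.sum_congr rfl fun j hj => ?_
      have : j ≠ k := fun h => hk' (h ▸ hj)
      simp [sg, this]
    rw [e1]
    have e2 : sg t k = -1 := by simp [sg, hkt]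
    have e3 : sg (insert k t) k = 1 := by simp [sg]
    rw [e2, e3]
    set S := ∑ j ∈ G ∪ E', sg t j * a j
    have := Real.rpow_arith_mean_le_arith_mean_rpow Finset.univ (fun _ : Bool => (2 : ℝ)⁻¹)
      (fun b => if b then |-1 * a k + S| else |1 * a k + S|) (fun _ _ => by positivity) (by simp)
      (fun b _ => by split_ifs <;> positivity) hr
    simp only [Fintype.sum_bool] at this
    rw [smul_eq_mul, mul_add]
    refine le_trans ?_ (by simpa using this)
    refine Real.rpow_le_rpow (abs_nonneg _) ?_ (by linarith)
    have : S = 2⁻¹ * ((-1 * a k + S) + (1 * a k + S)) := by ring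
    calc |S| = 2⁻¹ * |(-1 * a k + S) + (1 * a k + S)| := by
          conv_lhs => rw [this]
          rw [abs_mul, abs_of_pos (by norm_num : (0:ℝ) < 2⁻¹)]
      _ ≤ 2⁻¹ * (|(-1 * a k + S)| + |(1 * a k + S)|) := by
          gcongr; exact abs_add_le _ _
      _ = _ := by simp; ring
end av
end

section
def Fac (X Y : Type*) [NormedAddCommGroup X] [NormedSpace ℝ X] [NormedAddCommGroup Y]
    [NormedSpace ℝ Y] : Prop :=
  ∃ (A : X →L[ℝ] Y) (B : Y →L[ℝ] X), ∀ x, B (A x) = x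

lemma Fac.trans {X Y W : Type*} [NormedAddCommGroup X] [NormedSpace ℝ X] [NormedAddCommGroup Y]
    [NormedSpace ℝ Y] [NormedAddCommGroup W] [NormedSpace ℝ W] (h : Fac X Y) (h' : Fac Y W) :
    Fac X W := by
  obtain ⟨A, B, h⟩ := h
  obtain ⟨A', B', h'⟩ := h'
  exact ⟨A'.comp A, B.comp B', fun x => by simp [h, h']⟩

section
variable {p : ℝ≥0∞} [hp1 : Fact (1 ≤ p)] {ι : Type*}
  {Y : Type*} [NormedAddCommGroup Y] [NormedSpace ℝ Y]

lemma r_ge (hp : p ≠ ⊤) : 1 ≤ p.toReal := by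
  have := ENNReal.toReal_mono hp hp1.out
  simpa using this

lemma L2 (hp : p ≠ ⊤) (φ : ι → Y →L[ℝ] ℝ) (C : ℝ) (hC : 0 ≤ C)
    (h : ∀ f (F : Finset ι), ∃ G, F ⊆ G ∧ ∑ i ∈ G, |φ i f| ^ p.toReal ≤ (C * ‖f‖) ^ p.toReal) :
    ∃ T : Y →L[ℝ] lp (fun _ : ι => ℝ) p, ∀ f i, (T f : ι → ℝ) i = φ i f := by
  have hr := r_ge hp
  have h' : ∀ f (F : Finset ι), ∑ i ∈ F, ‖φ i f‖ ^ p.toReal ≤ (C * ‖f‖) ^ p.toReal := by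
    intro f F
    obtain ⟨G, hG, hb⟩ := h f F
    refine le_trans ?_ hb
    exact Finset.sum_le_sum_of_subset_of_nonneg hG (fun _ _ _ => by positivity)
  let T : Y →ₗ[ℝ] lp (fun _ : ι => ℝ) p :=
    { toFun := fun f => ⟨fun i => φ i f, memℓp_gen' (h' f)⟩
      map_add' := by intro f g; ext i; simp; rfl
      map_smul' := by intro f g; ext i; simp }
  refine ⟨T.mkContinuous C fun f => ?_, fun f i => rfl⟩
  exact lp.norm_le_of_forall_sum_le (by linarith) (by positivity) (h' f)

lemma L1 [CompleteSpace Y] (hp : p ≠ ⊤) (u : ι → Y) (C : ℝ) (hC : 0 ≤ C)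
    (h : ∀ (F : Finset ι), ∃ G, F ⊆ G ∧ ∀ a : ι → ℝ,
      ‖∑ i ∈ G, a i • u i‖ ≤ C * (∑ i ∈ G, |a i| ^ p.toReal) ^ (1 / p.toReal)) :
    ∃ T : lp (fun _ : ι => ℝ) p →L[ℝ] Y, ∀ a : lp (fun _ : ι => ℝ) p,
      HasSum (fun i => (a : ι → ℝ) i • u i) (T a) := by
  classical
  have hr := r_ge hp
  have h' : ∀ (F : Finset ι) (a : ι → ℝ),
      ‖∑ i ∈ F, a i • u i‖ ≤ C * (∑ i ∈ F, |a i| ^ p.toReal) ^ (1 / p.toReal) := by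
    intro F a
    obtain ⟨G, hG, hb⟩ := h F
    have := hb (fun i => if i ∈ F then a i else 0)
    have e1 : ∑ i ∈ G, (if i ∈ F then a i else 0) • u i = ∑ i ∈ F, a i • u i := by
      simp only [ite_smul, zero_smul, Finset.sum_ite_mem, Finset.inter_eq_right.2 hG]
    have e2 : ∑ i ∈ G, |if i ∈ F then a i else 0| ^ p.toReal = ∑ i ∈ F, |a i| ^ p.toReal := by
      rw [← Finset.inter_eq_right.2 hG, ← Finset.sum_ite_mem]
      refine Finset.sum_congr rfl fun i _ => ?_
      rw [Finset.inter_eq_right.2 hG]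
      split_ifs
      · rfl
      · rw [abs_zero, Real.zero_rpow (by linarith)]
    rw [e1, e2] at this
    exact this
  have hsum : ∀ a : lp (fun _ : ι => ℝ) p, Summable (fun i => (a : ι → ℝ) i • u i) := by
    intro a
    rw [summable_iff_vanishing_norm]
    intro ε hε
    have hs := (lp.memℓp a).summable (by linarith)
    rw [summable_iff_vanishing_norm] at hs
    have hε' : 0 < (ε / (C + 1)) ^ p.toReal := by positivity
    obtain ⟨s, hs⟩ := hs _ hε'
    refine ⟨s, fun t ht => ?_⟩
    have h1 := hs t ht
    rw [Real.norm_of_nonneg (by positivity)] at h1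
    have h2 : (∑ i ∈ t, |(a : ι → ℝ) i| ^ p.toReal) ^ (1 / p.toReal) ≤ ε / (C + 1) := by
      have := Real.rpow_le_rpow (by positivity) h1.le (z := 1 / p.toReal) (by positivity)
      rwa [← Real.rpow_mul (by positivity), mul_one_div_cancel (by linarith), Real.rpow_one] at this
    refine (h' t a).trans_lt ?_
    calc _ ≤ C * (ε / (C + 1)) := by gcongr
      _ < (C + 1) * (ε / (C + 1)) := by gcongr; linarith
      _ = ε := by field_simp
  let T : lp (fun _ : ι => ℝ) p →ₗ[ℝ] Y :=
    { toFun := fun a => ∑' i, (a : ι → ℝ) i • u i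
      map_add' := by
        intro a b
        rw [← (hsum a).tsum_add (hsum b)]
        simp [add_smul]
      map_smul' := by
        intro r a
        simp only [RingHom.id_apply]
        rw [← (hsum a).tsum_const_smul]
        simp [mul_smul] }
  refine ⟨T.mkContinuous C fun a => ?_, fun a => (hsum a).hasSum⟩
  have : Filter.Tendsto (fun F : Finset ι => ‖∑ i ∈ F, (a : ι → ℝ) i • u i‖) Filter.atTop
    (nhds ‖T a‖) := by
      have := (hsum a).hasSum.norm
      simp only [HasSum, SummationFilter.unconditional_filter] at this
      exact this
  refine le_of_tendsto this (Filter.Eventually.of_forall fun F => (h' F a).trans ?_)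
  gcongr
  have := Real.rpow_le_rpow (by positivity) (lp.sum_rpow_le_norm_rpow (by linarith) a F)
    (z := 1 / p.toReal) (by positivity)
  rw [← Real.rpow_mul (by positivity), mul_one_div_cancel (by linarith), Real.rpow_one] at this
  exact this

/-- unit vectors -/
def ee (p : ℝ≥0∞) [Fact (1 ≤ p)] {ι : Type*} (i : ι) : lp (fun _ : ι => ℝ) p := by
  classical exact lp.single p i (1 : ℝ)

def evv (p : ℝ≥0∞) [Fact (1 ≤ p)] {ι : Type*} (i : ι) : lp (fun _ : ι => ℝ) p →L[ℝ] ℝ :=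
  lp.evalCLM ℝ (fun _ : ι => ℝ) p i

lemma evv_apply (i : ι) (f : lp (fun _ : ι => ℝ) p) : evv p i f = (f : ι → ℝ) i := rfl

lemma ee_self (i : ι) : (ee p i : ι → ℝ) i = 1 := by
  unfold ee; simp

lemma ee_ne (i j : ι) (h : j ≠ i) : (ee p i : ι → ℝ) j = 0 := by
  unfold ee; simp [h]

lemma ee_apply [DecidableEq ι] (i j : ι) : (ee p i : ι → ℝ) j = if j = i then 1 else 0 := by
  split_ifs with h
  · rw [h, ee_self]
  · exact ee_ne i j h

lemma hasSum_ee (hp : p ≠ ⊤) (f : lp (fun _ : ι => ℝ) p) :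
    HasSum (fun i => (f : ι → ℝ) i • ee p i) f := by
  classical
  convert lp.hasSum_single hp f using 2 with i
  ext j
  rw [lp.coeFn_smul, Pi.smul_apply, ee_apply]
  by_cases h : j = i
  · subst h; simp
  · simp [h]

lemma norm_sum_ee (hp : p ≠ ⊤) (a : ι → ℝ) (F : Finset ι) :
    ‖∑ i ∈ F, a i • ee p i‖ = (∑ i ∈ F, |a i| ^ p.toReal) ^ (1 / p.toReal) := by
  classical
  have hr := r_ge hp
  have h := lp.norm_sum_single (p := p) (E := fun _ : ι => ℝ) (by linarith) a F
  have e : ∑ i ∈ F, a i • ee p i = ∑ i ∈ F, lp.single p i (a i) := by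
    refine Finset.sum_congr rfl fun i _ => ?_
    ext j
    rw [lp.coeFn_smul, Pi.smul_apply, ee_apply]
    by_cases h : j = i
    · subst h; simp
    · simp [h]
  rw [e]
  simp only [Real.norm_eq_abs] at h
  rw [← h, ← Real.rpow_mul (norm_nonneg _), mul_one_div_cancel (by linarith), Real.rpow_one]

lemma norm_ee (hp : p ≠ ⊤) (i : ι) : ‖ee p i‖ = 1 := by
  have := norm_sum_ee hp (fun _ => 1) {i}
  simpa using this

lemma sum_le_norm (hp : p ≠ ⊤) (f : lp (fun _ : ι => ℝ) p) (F : Finset ι) :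
    ∑ i ∈ F, |(f : ι → ℝ) i| ^ p.toReal ≤ ‖f‖ ^ p.toReal :=
  lp.sum_rpow_le_norm_rpow (by linarith [r_ge hp]) f F

/-- sum with injective reindexing -/
lemma sum_le_norm_inj {κ : Type*} (hp : p ≠ ⊤) (f : lp (fun _ : ι => ℝ) p) (F : Finset κ)
    (e : κ → ι) (he : Set.InjOn e F) :
    ∑ i ∈ F, |(f : ι → ℝ) (e i)| ^ p.toReal ≤ ‖f‖ ^ p.toReal := by
  classical
  refine le_trans ?_ (sum_le_norm hp f (F.image e))
  rw [Finset.sum_image he]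

lemma norm_sum_ee_inj {κ : Type*} (hp : p ≠ ⊤) (a : κ → ℝ) (F : Finset κ)
    (e : κ → ι) (he : Function.Injective e) :
    ‖∑ i ∈ F, a i • ee p (e i)‖ = (∑ i ∈ F, |a i| ^ p.toReal) ^ (1 / p.toReal) := by
  classical
  cases isEmpty_or_nonempty κ
  · have : F = ∅ := Finset.eq_empty_of_isEmpty F
    subst this
    have hr := r_ge hp
    simp
    rw [Real.zero_rpow]; positivity
  have h := norm_sum_ee hp (fun i => a (Function.invFun e i)) (F.image e)
  rw [Finset.sum_image he.injOn, Finset.sum_image he.injOn] at h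
  simpa [Function.leftInverse_invFun he _] using h

lemma fac_countable [Countable ι] (hp : p ≠ ⊤) :
    Fac (lp (fun _ : ι => ℝ) p) (lp (fun _ : ℕ => ℝ) p) := by
  obtain ⟨e, he⟩ := exists_injective_nat ι
  obtain ⟨A, hA⟩ := L1 (Y := lp (fun _ : ℕ => ℝ) p) hp (fun i : ι => ee p (e i)) 1 zero_le_one
    (fun F => ⟨F, subset_rfl, fun a => by rw [norm_sum_ee_inj hp _ _ _ he, one_mul]⟩)
  obtain ⟨B, hB⟩ := L2 hp (fun i : ι => evv p (e i)) 1 zero_le_one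
    (fun f F => ⟨F, subset_rfl, by
      rw [one_mul]; exact sum_le_norm_inj hp f F e he.injOn⟩)
  refine ⟨A, B, fun a => ?_⟩
  ext i
  rw [hB]
  have h1 := (hA a).mapL (evv p (e i))
  simp only [map_smul, evv_apply, smul_eq_mul] at h1
  refine h1.unique ?_
  convert hasSum_single i ?_ using 1
  · simp [ee_self]
  · intro j hj
    rw [ee_ne _ _ (fun h => hj (he h).symm), mul_zero]

/-- unit basis is unconditional -/
lemma UB_ee (hp : p ≠ ⊤) : UB (fun i : ι => ee p i) (fun i => evv p i) 1 := by
  have hr := r_ge hp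
  refine ⟨fun j => ee_self (p := p) j, fun i j h => ee_ne (p := p) j i h, fun f => hasSum_ee hp f, zero_le_one, ?_⟩
  intro F s M hM hs f
  rw [norm_sum_ee hp, mul_one]
  have : ∑ i ∈ F, |s i * evv p i f| ^ p.toReal ≤ (M * ‖f‖) ^ p.toReal := by
    calc _ ≤ ∑ i ∈ F, M ^ p.toReal * |(f : ι → ℝ) i| ^ p.toReal := by
          refine Finset.sum_le_sum fun i hi => ?_
          rw [← Real.mul_rpow hM (abs_nonneg _), abs_mul]
          refine Real.rpow_le_rpow (by positivity) ?_ (by linarith)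
          exact mul_le_mul_of_nonneg_right (hs i hi) (abs_nonneg _)
      _ ≤ _ := by
          rw [← Finset.mul_sum, Real.mul_rpow hM (norm_nonneg _)]
          gcongr
          exact sum_le_norm hp f F
  have := Real.rpow_le_rpow (by positivity) this (z := 1 / p.toReal) (by positivity)
  rwa [← Real.rpow_mul (by positivity), mul_one_div_cancel (by linarith), Real.rpow_one] at this
end
end

section
open Classical in
lemma av_restrict {J Y : Type*} [AddCommGroup Y] [Module ℝ Y]
    (E F : Finset J) (hEF : E ⊆ F)
    (g : Finset J → ℝ) (y : J → Y) :
    av E (fun t => g t • ∑ j ∈ E, sg t j • y j) =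
      av F (fun t => g (t ∩ E) • ∑ j ∈ F, sg t j • y j) := by
  have e1 : ∀ (G : Finset J) (h : Finset J → ℝ), av G (fun t => h t • ∑ j ∈ G, sg t j • y j) =
      ∑ j ∈ G, av G (fun t => sg t j • h t) • y j := by
    intro G h
    simp only [Finset.smul_sum]
    rw [av_sum]
    refine Finset.sum_congr rfl fun j _ => ?_
    rw [← av_smul_const]
    refine av_congr _ fun t _ => ?_
    rw [smul_smul, smul_eq_mul, mul_comm]
  rw [e1, e1 F (fun t => g (t ∩ E))]
  rw [← Finset.sum_subset hEF]
  · refine Finset.sum_congr rfl fun j hj => ?_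
    rw [← av_inter E F hEF]
    congr 1
    refine av_congr _ fun t _ => ?_
    congr 1
    by_cases h : j ∈ t <;> simp [sg, h, hj]
  · intro j hjF hjE
    rw [av_toggle F j hjF, zero_smul]
    intro t _
    congr 1
    ext i
    simp only [Finset.mem_inter, Finset.mem_insert]
    constructor
    · rintro ⟨h | h, h'⟩
      · subst h; exact absurd h' hjE
      · exact ⟨h, h'⟩
    · rintro ⟨h, h'⟩; exact ⟨Or.inr h, h'⟩

section
variable {p : ℝ≥0∞} [hp1 : Fact (1 ≤ p)] {J Y : Type*} [NormedAddCommGroup Y] [NormedSpace ℝ Y]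

lemma UB.ext_c {x : J → Y} {c : J → Y →L[ℝ] ℝ} {K : ℝ} (h : UB x c K) {f g : Y}
    (e : ∀ j, c j f = c j g) : f = g := by
  have h1 := h.hs f
  simp only [e] at h1
  exact h1.unique (h.hs g)

lemma sigma_cover {κ : ℕ → Type*} [∀ n, Fintype (κ n)] (F : Finset (Σ n, κ n)) :
    ∃ N, F ⊆ (Finset.range N).sigma (fun _ => Finset.univ) := by
  refine ⟨F.sup (fun i => i.1) + 1, fun i hi => ?_⟩
  simp only [Finset.mem_sigma, Finset.mem_range, Finset.mem_univ, and_true]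
  exact Nat.lt_succ_of_le (Finset.le_sup (f := fun i => i.1) hi)

/-- operator U -/
lemma exists_U {x : J → Y} {c : J → Y →L[ℝ] ℝ} {K : ℝ} (h : UB x c K) (hp : p ≠ ⊤)
    (P : Y →L[ℝ] lp (fun _ : ℕ => ℝ) p) (E : ℕ → Finset J) (α : ℕ → ℝ) (hα : ∀ n, 0 ≤ α n)
    (hα' : ∀ n, α n ^ p.toReal = ((2 : ℝ) ^ (E n).card)⁻¹) :
    ∃ U : Y →L[ℝ] lp (fun _ : (Σ n, (E n).powerset) => ℝ) p, ∀ f i,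
      (U f : (Σ n, (E n).powerset) → ℝ) i =
        α i.1 * ∑ j ∈ E i.1, sg i.2.1 j * ((P (x j) : ℕ → ℝ) i.1 * c j f) := by
  classical
  have hr := r_ge hp
  have hL := L2 hp (fun i : (Σ n, (E n).powerset) =>
      α i.1 • ∑ j ∈ E i.1, (sg i.2.1 j * (P (x j) : ℕ → ℝ) i.1) • c j) (‖P‖ * K)
      (mul_nonneg (norm_nonneg _) h.K_nonneg)
  refine (fun hb => ?_ : _ → _) (hL ?_)
  · obtain ⟨U, hU⟩ := hb
    refine ⟨U, fun f i => ?_⟩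
    rw [hU]
    simp [mul_assoc]
  · intro f F0
    obtain ⟨N, hN⟩ := sigma_cover F0
    refine ⟨_, hN, ?_⟩
    rw [Finset.sum_sigma]
    let F := (Finset.range N).biUnion E
    have hE : ∀ n ∈ Finset.range N, E n ⊆ F := fun n hn => Finset.subset_biUnion_of_mem E hn
    calc _ = ∑ n ∈ Finset.range N, av (E n)
          (fun t => |∑ j ∈ E n, sg t j * ((P (x j) : ℕ → ℝ) n * c j f)| ^ p.toReal) := by
          refine Finset.sum_congr rfl fun n _ => ?_
          unfold av
          rw [← hα', smul_eq_mul, Finset.mul_sum,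
            ← Finset.sum_coe_sort (E n).powerset]
          refine Finset.sum_congr rfl fun t _ => ?_
          rw [← Real.mul_rpow (hα n) (abs_nonneg _), ← abs_of_nonneg (hα n), ← abs_mul]
          simp [mul_assoc]
      _ ≤ ∑ n ∈ Finset.range N, av F
          (fun t => |∑ j ∈ F, sg t j * ((P (x j) : ℕ → ℝ) n * c j f)| ^ p.toReal) :=
          Finset.sum_le_sum fun n hn => av_contract _ hr _ _ _ (hE n hn)
      _ = av F (fun t => ∑ n ∈ Finset.range N,
            |(P (∑ j ∈ F, (sg t j * c j f) • x j) : ℕ → ℝ) n| ^ p.toReal) := by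
          rw [av_sum]
          refine Finset.sum_congr rfl fun n _ => av_congr _ fun t _ => ?_
          congr 2
          rw [← evv_apply, map_sum, map_sum]
          refine Finset.sum_congr rfl fun j _ => ?_
          simp only [map_smul, evv_apply, smul_eq_mul]
          ring
      _ ≤ av F (fun _ => (‖P‖ * K * ‖f‖) ^ p.toReal) := by
          refine av_mono _ fun t _ => (sum_le_norm hp _ _).trans ?_
          refine Real.rpow_le_rpow (norm_nonneg _) ?_ (by linarith)
          refine (P.le_opNorm _).trans ?_
          rw [mul_assoc]
          gcongr
          have := h.bd F (fun j => sg t j) 1 zero_le_one (fun j _ => (abs_sg t j).le) f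
          simpa using this
      _ = _ := av_const _ _

/-- operator V -/
lemma exists_V [CompleteSpace Y] {x : J → Y} {c : J → Y →L[ℝ] ℝ} {K : ℝ} (h : UB x c K)
    (hp : p ≠ ⊤)
    (I : lp (fun _ : ℕ => ℝ) p →L[ℝ] Y) (E : ℕ → Finset J) (α : ℕ → ℝ) (hα : ∀ n, 0 < α n)
    (hα' : ∀ n, α n ^ p.toReal = ((2 : ℝ) ^ (E n).card)⁻¹) (m : J → ℝ) (M : ℝ) (hM : 0 ≤ M)
    (hm : ∀ n, ∀ j ∈ E n, |m j| ≤ M) :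
    ∃ V : lp (fun _ : (Σ n, (E n).powerset) => ℝ) p →L[ℝ] Y,
      ∀ a : lp (fun _ : (Σ n, (E n).powerset) => ℝ) p,
      HasSum (fun i => (a : (Σ n, (E n).powerset) → ℝ) i •
        ((((2 : ℝ) ^ (E i.1).card)⁻¹ / α i.1) • ∑ j ∈ E i.1,
          sg i.2.1 j • (m j * c j (I (ee p i.1))) • x j)) (V a) := by
  classical
  have hr := r_ge hp
  refine L1 hp _ (M * K * ‖I‖) (by have := h.K_nonneg; positivity) fun F0 => ?_
  obtain ⟨N, hN⟩ := sigma_cover F0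
  refine ⟨_, hN, fun a => ?_⟩
  rw [Finset.sum_sigma, Finset.sum_sigma]
  let F := (Finset.range N).biUnion E
  have hE : ∀ n ∈ Finset.range N, E n ⊆ F := fun n hn => Finset.subset_biUnion_of_mem E hn
  let g : ℕ → Finset J → ℝ := fun n t =>
    if ht : t ∈ (E n).powerset then a ⟨n, t, ht⟩ / α n else 0
  have hg : ∀ n (t : (E n).powerset), g n t.1 = a ⟨n, t⟩ / α n := by
    intro n t
    simp only [g]
    rw [dif_pos t.2]
  let f : Finset J → lp (fun _ : ℕ => ℝ) p := fun t =>
    ∑ n ∈ Finset.range N, g n (t ∩ E n) • ee p n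
  have key : ∑ n ∈ Finset.range N, ∑ t : (E n).powerset, a ⟨n, t⟩ •
      ((((2 : ℝ) ^ (E n).card)⁻¹ / α n) • ∑ j ∈ E n,
          sg t.1 j • (m j * c j (I (ee p n))) • x j) =
      av F (fun t => ∑ j ∈ F, ((sg t j * m j) * c j (I (f t))) • x j) := by
    calc _ = ∑ n ∈ Finset.range N, av (E n) (fun t => g n t • ∑ j ∈ E n,
          sg t j • (m j * c j (I (ee p n))) • x j) := by
          refine Finset.sum_congr rfl fun n _ => ?_
          unfold av
          rw [Finset.smul_sum, ← Finset.sum_coe_sort (E n).powerset]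
          refine Finset.sum_congr rfl fun t _ => ?_
          rw [hg, smul_smul, smul_smul]
          congr 1
          ring
      _ = ∑ n ∈ Finset.range N, av F (fun t => g n (t ∩ E n) • ∑ j ∈ F,
          sg t j • (m j * c j (I (ee p n))) • x j) :=
          Finset.sum_congr rfl fun n hn => av_restrict _ _ (hE n hn) _ _
      _ = _ := by
          rw [← av_sum]
          refine av_congr _ fun t _ => ?_
          simp only [Finset.smul_sum]
          rw [Finset.sum_comm]
          refine Finset.sum_congr rfl fun j _ => ?_
          simp only [f, map_sum, map_smul, smul_smul, Finset.mul_sum, Finset.sum_smul]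
          refine Finset.sum_congr rfl fun n _ => ?_
          congr 1
          simp only [smul_eq_mul]
          ring
  rw [key]
  have b1 : ∀ t, ‖∑ j ∈ F, ((sg t j * m j) * c j (I (f t))) • x j‖ ≤ M * K * ‖I‖ * ‖f t‖ := by
    intro t
    have := h.bd F (fun j => sg t j * m j) M hM (fun j hj => by
      rw [abs_mul, abs_sg, one_mul]
      obtain ⟨n, _, hn⟩ := Finset.mem_biUnion.1 hj
      exact hm n j hn) (I (f t))
    refine this.trans ?_
    rw [mul_assoc (M * K)]
    have := h.K_nonneg
    gcongr
    exact I.le_opNorm _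
  have b2 : av F (fun t => ‖f t‖) ≤
      (∑ n ∈ Finset.range N, ∑ t : (E n).powerset, |a ⟨n, t⟩| ^ p.toReal) ^ (1 / p.toReal) := by
    have c1 := av_rpow_le F (fun t => ‖f t‖) (fun _ => norm_nonneg _) _ hr
    have c2 : av F (fun t => ‖f t‖ ^ p.toReal) =
        ∑ n ∈ Finset.range N, ∑ t : (E n).powerset, |a ⟨n, t⟩| ^ p.toReal := by
      calc _ = av F (fun t => ∑ n ∈ Finset.range N, |g n (t ∩ E n)| ^ p.toReal) := by
            refine av_congr _ fun t _ => ?_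
            rw [norm_sum_ee hp, ← Real.rpow_mul (by positivity), one_div_mul_cancel (by linarith),
              Real.rpow_one]
        _ = ∑ n ∈ Finset.range N, av (E n) (fun t => |g n t| ^ p.toReal) := by
            rw [av_sum]
            exact Finset.sum_congr rfl fun n hn => av_inter _ _ (hE n hn) (fun t => |g n t| ^ p.toReal)
        _ = _ := by
            refine Finset.sum_congr rfl fun n _ => ?_
            unfold av
            rw [← hα', smul_eq_mul, Finset.mul_sum,
            ← Finset.sum_coe_sort (E n).powerset]
            refine Finset.sum_congr rfl fun t _ => ?_
            rw [hg, ← Real.mul_rpow (hα n).le (abs_nonneg _), abs_div, abs_of_pos (hα n),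
              mul_div_cancel₀ _ (hα n).ne']
    rw [c2] at c1
    have := Real.rpow_le_rpow
      (Real.rpow_nonneg (av_nonneg F (fun _ _ => norm_nonneg _)) _) c1
      (z := 1 / p.toReal) (by positivity)
    rwa [← Real.rpow_mul (av_nonneg F (fun _ _ => norm_nonneg _)),
      mul_one_div_cancel (by linarith), Real.rpow_one] at this
  calc _ ≤ av F (fun t => M * K * ‖I‖ * ‖f t‖) :=
        (norm_av_le _ _).trans (av_mono _ fun t _ => b1 t)
    _ = M * K * ‖I‖ * av F (fun t => ‖f t‖) := av_smul F (M * K * ‖I‖) (fun t => ‖f t‖)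
    _ ≤ _ := by
        have := h.K_nonneg
        gcongr
end
end

section
section
variable {p : ℝ≥0∞} [hp1 : Fact (1 ≤ p)] {J Y : Type*} [NormedAddCommGroup Y] [NormedSpace ℝ Y]

lemma mem_closed_of_hasSum {ι : Type*} (S : Submodule ℝ Y) (hS : IsClosed (S : Set Y))
    {g : ι → Y} {y : Y} (hg : ∀ i, g i ∈ S) (h : HasSum g y) : y ∈ S := by
  refine hS.mem_of_tendsto (f := fun F : Finset ι => ∑ i ∈ F, g i) (b := Filter.atTop) ?_
    (Filter.Eventually.of_forall fun F => S.sum_mem fun i _ => hg i)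
  simpa [HasSum] using h

/-- factor through a closed span -/
lemma fac_span {X : Type*} [NormedAddCommGroup X] [NormedSpace ℝ X] (x : J → Y) (J' : Set J)
    (U : Y →L[ℝ] X) (V : X →L[ℝ] Y)
    (hV : ∀ a, V a ∈ (Submodule.span ℝ (x '' J')).topologicalClosure)
    (h : ∀ j ∈ J', V (U (x j)) = x j) :
    Fac (Submodule.span ℝ (x '' J')).topologicalClosure X := by
  refine ⟨U.comp (Submodule.subtypeL _), V.codRestrict _ hV, fun z => ?_⟩
  have hle : (Submodule.span ℝ (x '' J')).topologicalClosure ≤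
      LinearMap.ker ((V.comp U - ContinuousLinearMap.id ℝ Y : Y →L[ℝ] Y) : Y →ₗ[ℝ] Y) := by
    refine Submodule.topologicalClosure_minimal _ ?_ (ContinuousLinearMap.isClosed_ker _)
    rw [Submodule.span_le]
    rintro _ ⟨j, hj, rfl⟩
    simp [h j hj]
  have := hle z.2
  ext
  simpa [sub_eq_zero] using this

lemma w_summable {x : J → Y} {c : J → Y →L[ℝ] ℝ} {K : ℝ} (h : UB x c K)
    (I : lp (fun _ : ℕ => ℝ) p →L[ℝ] Y) (P : Y →L[ℝ] lp (fun _ : ℕ => ℝ) p) (n : ℕ) :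
    HasSum (fun j => c j (I (ee p n)) * (P (x j) : ℕ → ℝ) n) ((P (I (ee p n)) : ℕ → ℝ) n) := by
  have := (h.hs (I (ee p n))).mapL ((evv p n).comp P)
  simpa [evv_apply] using this

theorem F1 [CompleteSpace Y] {x : J → Y} {c : J → Y →L[ℝ] ℝ} {K : ℝ} (h : UB x c K)
    (hp : p ≠ ⊤)
    (I : lp (fun _ : ℕ => ℝ) p →L[ℝ] Y) (P : Y →L[ℝ] lp (fun _ : ℕ => ℝ) p)
    (J' : Set J) (δ : ℝ) (hδ : 0 < δ) (hJ : ∀ j ∈ J', δ ≤ c j (I (P (x j)))) :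
    Fac (Submodule.span ℝ (x '' J')).topologicalClosure (lp (fun _ : ℕ => ℝ) p) := by
  classical
  have hr := r_ge hp
  let w : J → ℕ → ℝ := fun j n => c j (I (ee p n)) * (P (x j) : ℕ → ℝ) n
  have hw1 : ∀ n, Summable (fun j => w j n) := fun n => (w_summable h I P n).summable
  have hw2 : ∀ j, HasSum (fun n => w j n) (c j (I (P (x j)))) := by
    intro j
    have := (hasSum_ee hp (P (x j))).mapL ((c j).comp I)
    simpa [w, mul_comm] using this
  let η : ℕ → ℝ := fun n => (δ / 2) / 2 / 2 ^ n
  have hη : HasSum η (δ / 2) := hasSum_geometric_two' _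
  have hη0 : ∀ n, 0 < η n := fun n => by positivity
  have hfin : ∀ n, {j | j ∈ J' ∧ η n < |w j n|}.Finite := by
    intro n
    have := (hw1 n).tendsto_cofinite_zero
    have := this.eventually (Metric.ball_mem_nhds 0 (hη0 n))
    rw [Filter.eventually_cofinite] at this
    refine this.subset ?_
    rintro j ⟨_, hj⟩
    simp only [Metric.mem_ball, dist_zero_right, Real.norm_eq_abs, Set.mem_setOf_eq, not_lt]
    exact hj.le
  let E : ℕ → Finset J := fun n => (hfin n).toFinset
  have hE : ∀ n j, j ∈ E n ↔ j ∈ J' ∧ η n < |w j n| := fun n j => by simp [E]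
  let d : J → ℝ := fun j => ∑' n, if j ∈ E n then w j n else 0
  have hd1 : ∀ j, HasSum (fun n => if j ∈ E n then w j n else 0) (d j) := by
    intro j
    refine Summable.hasSum ?_
    refine Summable.of_norm_bounded (hw2 j).summable.abs fun n => ?_
    split_ifs
    · exact le_rfl
    · simp
  have hd2 : ∀ j ∈ J', δ / 2 ≤ d j := by
    intro j hj
    have h1 := (hw2 j).sub (hd1 j)
    have h2 := hasSum_le (fun n => ?_) h1 hη
    · have := hJ j hj
      linarith
    · by_cases hjn : j ∈ E n
      · simp [hjn, (hη0 n).le]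
      · simp only [hjn, if_false, sub_zero]
        rw [hE] at hjn
        push Not at hjn
        exact (le_abs_self _).trans (hjn hj)
  let α : ℕ → ℝ := fun n => (((2 : ℝ) ^ (E n).card)⁻¹) ^ (1 / p.toReal)
  have hα : ∀ n, 0 < α n := fun n => by positivity
  have hα' : ∀ n, α n ^ p.toReal = ((2 : ℝ) ^ (E n).card)⁻¹ := by
    intro n
    rw [← Real.rpow_mul (by positivity), one_div_mul_cancel (by linarith), Real.rpow_one]
  obtain ⟨U, hU⟩ := exists_U h hp P E α (fun n => (hα n).le) hα'
  obtain ⟨V, hV⟩ := exists_V h hp I E α hα hα' (fun j => (d j)⁻¹) (2 / δ) (by positivity) (by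
    intro n j hj
    have := hd2 j ((hE n j).1 hj).1
    have h0 : 0 < d j := by linarith
    rw [abs_inv, abs_of_pos h0, inv_le_comm₀ h0 (by positivity), inv_div]
    exact this)
  refine Fac.trans (fac_span x J' U V ?_ ?_) (fac_countable hp)
  · intro a
    refine mem_closed_of_hasSum _ (Submodule.isClosed_topologicalClosure _) (fun i => ?_) (hV a)
    refine Submodule.smul_mem _ _ (Submodule.smul_mem _ _ (Submodule.sum_mem _ fun j hj => ?_))
    refine Submodule.smul_mem _ _ (Submodule.smul_mem _ _ ?_)
    exact Submodule.le_topologicalClosure _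
      (Submodule.subset_span ⟨j, ((hE _ j).1 hj).1, rfl⟩)
  · intro i hi
    have hdi : d i ≠ 0 := by have := hd2 i hi; intro h0; linarith
    refine h.ext_c fun j => ?_
    have h1 := (hV (U (x i))).mapL (c j)
    have cx : ∀ k l, c k (x l) = if k = l then 1 else 0 := by
      intro k l
      split_ifs with hkl
      · rw [hkl]; exact h.bi_self l
      · exact h.bi_ne _ _ hkl
    have h2 : ∀ n, HasSum (fun t : (E n).powerset => c j ((U (x i) : (Σ n, (E n).powerset) → ℝ) ⟨n, t⟩ •
        ((((2 : ℝ) ^ (E n).card)⁻¹ / α n) • ∑ j ∈ E n,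
          sg t.1 j • ((d j)⁻¹ * c j (I (ee p n))) • x j)))
          (if j = i then (d i)⁻¹ * (if i ∈ E n then w i n else 0) else 0) := by
      intro n
      convert hasSum_fintype _ using 1
      have e : ∀ t : (E n).powerset, c j ((U (x i) : (Σ n, (E n).powerset) → ℝ) ⟨n, t⟩ •
        ((((2 : ℝ) ^ (E n).card)⁻¹ / α n) • ∑ j ∈ E n,
          sg t.1 j • ((d j)⁻¹ * c j (I (ee p n))) • x j)) =
          ((2 : ℝ) ^ (E n).card)⁻¹ * (if i ∈ E n ∧ j ∈ E n then (sg t.1 i * sg t.1 j) *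
            ((P (x i) : ℕ → ℝ) n * ((d j)⁻¹ * c j (I (ee p n)))) else 0) := by
        intro t
        rw [hU]
        simp only [map_smul, map_sum, cx, smul_eq_mul, mul_ite, mul_one, mul_zero,
          Finset.sum_ite_eq, Finset.sum_ite_eq']
        have := (hα n).ne'
        by_cases h1 : i ∈ E n <;> by_cases h2 : j ∈ E n <;> simp only [h1, h2, if_true, if_false,
          and_self, and_true, true_and, false_and, and_false, mul_zero, zero_mul]
        field_simp
      simp only [e]
      rw [← Finset.mul_sum, Finset.sum_coe_sort (E n).powerset (fun t => if i ∈ E n ∧ j ∈ E n then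
        (sg t i * sg t j) * ((P (x i) : ℕ → ℝ) n * ((d j)⁻¹ * c j (I (ee p n)))) else 0)]
      change _ = av (E n) (fun t => if i ∈ E n ∧ j ∈ E n then
        (sg t i * sg t j) * ((P (x i) : ℕ → ℝ) n * ((d j)⁻¹ * c j (I (ee p n)))) else 0)
      by_cases hij : j = i
      · subst hij
        simp only [if_true, and_self, sg_mul_self, one_mul]
        rw [av_const]
        by_cases h1 : j ∈ E n
        · simp only [h1, if_true, w]; ring
        · simp [h1]
      · simp only [hij, if_false]
        by_cases h1 : i ∈ E n ∧ j ∈ E n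
        · simp only [h1, and_self, if_true]
          have := av_smul_const (E n) (fun t => sg t i * sg t j)
            ((P (x i) : ℕ → ℝ) n * ((d j)⁻¹ * c j (I (ee p n))))
          simp only [smul_eq_mul] at this
          rw [this, av_sg_sg _ _ _ h1.1 (Ne.symm hij), zero_mul]
        · simp only [h1, if_false]; rw [av_zero]
    have h3 := h1.sigma h2
    refine h3.unique ?_
    rw [cx]
    by_cases hij : j = i
    · simp only [hij, if_true]
      have := (hd1 i).mul_left (d i)⁻¹
      rwa [inv_mul_cancel₀ hdi] at this
    · simp only [hij, if_false]
      exact hasSum_zero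
end
end

section
section
variable {p : ℝ≥0∞} [hp1 : Fact (1 ≤ p)] {J Y : Type*} [NormedAddCommGroup Y] [NormedSpace ℝ Y]

lemma av_diag (F : Finset ℕ) (v : ℕ → ℕ → Y) :
    av F (fun t => ∑ k ∈ F, sg t k • ∑ l ∈ F, sg t l • v k l) = ∑ k ∈ F, v k k := by
  classical
  rw [av_sum]
  refine Finset.sum_congr rfl fun k hk => ?_
  simp only [Finset.smul_sum, smul_smul]
  rw [av_sum, Finset.sum_eq_single k]
  · simp only [sg_mul_self, one_smul]
    rw [av_const]
  · intro l hl hlk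
    rw [av_smul_const, av_sg_sg F k l hk hlk.symm, zero_smul]
  · exact fun h => absurd hk h

lemma block_select {x : J → Y} {c : J → Y →L[ℝ] ℝ}
    (hp : p ≠ ⊤) (A : lp (fun _ : ℕ => ℝ) p →L[ℝ] Y) (B : Y →L[ℝ] lp (fun _ : ℕ => ℝ) p)
    (J' : Set J) (δ : ℝ) (hδ : 0 < δ)
    (hf : ∃ᶠ n in Filter.atTop, ∃ F : Finset J, (F : Set J) ⊆ J' ∧
      δ ≤ ∑ j ∈ F, c j (A (ee p n)) * (B (x j) : ℕ → ℝ) n) :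
    ∃ (n : ℕ → ℕ) (E : ℕ → Finset J), Function.Injective n ∧
      (∀ k l, k ≠ l → Disjoint (E k) (E l)) ∧ (∀ k, (E k : Set J) ⊆ J') ∧
      ∀ k, δ / 2 ≤ ∑ j ∈ E k, c j (A (ee p (n k))) * (B (x j) : ℕ → ℝ) (n k) := by
  classical
  have hr := r_ge hp
  let w : J → ℕ → ℝ := fun j n => c j (A (ee p n)) * (B (x j) : ℕ → ℝ) n
  have hw : ∀ j, Filter.Tendsto (fun n => |w j n|) Filter.atTop (nhds 0) := by
    intro j
    have h2 := (hasSum_ee hp (B (x j))).mapL ((c j).comp A)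
    have h3 : HasSum (fun n => w j n) (c j (A (B (x j)))) := by simpa [w, mul_comm] using h2
    simpa using h3.summable.tendsto_atTop_zero.abs
  have hG : ∀ G : Finset J, Filter.Tendsto (fun n => ∑ j ∈ G, |w j n|) Filter.atTop (nhds 0) := by
    intro G
    simpa using tendsto_finsetSum G (fun j _ => hw j)
  let r : ℕ × Finset J → ℕ × Finset J → Prop := fun a b => a.1 ≠ b.1 ∧ Disjoint a.2 b.2
  have : Std.Symm r := ⟨fun a b h => ⟨h.1.symm, h.2.symm⟩⟩
  obtain ⟨f, hf1, hf2⟩ := exists_seq_of_forall_finset_exists'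
    (fun a : ℕ × Finset J => (a.2 : Set J) ⊆ J' ∧ δ / 2 ≤ ∑ j ∈ a.2, w j a.1) r (by
      intro s _
      let G := s.biUnion (fun a => a.2)
      have e1 : ∀ᶠ n in Filter.atTop, ∑ j ∈ G, |w j n| < δ / 2 :=
        (hG G).eventually (gt_mem_nhds (by positivity))
      have e2 : ∀ᶠ n in Filter.atTop, ∀ a ∈ s, a.1 < n := by
        rw [Filter.eventually_all_finset]
        exact fun a _ => Filter.eventually_gt_atTop _
      obtain ⟨n, ⟨F, hF1, hF2⟩, h1, h2⟩ := (hf.and_eventually (e1.and e2)).exists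
      refine ⟨(n, F \ G), ⟨?_, ?_⟩, fun a ha => ⟨(h2 a ha).ne, ?_⟩⟩
      · exact fun j hj => hF1 (Finset.sdiff_subset hj)
      · have e3 := Finset.sum_inter_add_sum_sdiff F G (fun j => w j n)
        have e4 : ∑ j ∈ F ∩ G, w j n ≤ ∑ j ∈ G, |w j n| :=
          (Finset.sum_le_sum fun j _ => le_abs_self _).trans
            (Finset.sum_le_sum_of_subset_of_nonneg Finset.inter_subset_right
              (fun _ _ _ => abs_nonneg _))
        change δ ≤ ∑ j ∈ F, w j n at hF2
        simp only
        linarith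
      · refine Finset.disjoint_left.2 fun j hj hj' => ?_
        exact (Finset.mem_sdiff.1 hj').2 (Finset.mem_biUnion.2 ⟨a, ha, hj⟩))
  refine ⟨fun k => (f k).1, fun k => (f k).2, ?_, fun k l hkl => (hf2 hkl).2,
    fun k => (hf1 k).1, fun k => (hf1 k).2⟩
  intro k l hkl
  by_contra hne
  exact (hf2 hne).1 hkl

theorem block [CompleteSpace Y] {x : J → Y} {c : J → Y →L[ℝ] ℝ} {K : ℝ} (h : UB x c K)
    (hp : p ≠ ⊤) (A : lp (fun _ : ℕ => ℝ) p →L[ℝ] Y) (B : Y →L[ℝ] lp (fun _ : ℕ => ℝ) p)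
    (J' : Set J) (δ : ℝ) (hδ : 0 < δ)
    (hf : ∃ᶠ n in Filter.atTop, ∃ F : Finset J, (F : Set J) ⊆ J' ∧
      δ ≤ ∑ j ∈ F, c j (A (ee p n)) * (B (x j) : ℕ → ℝ) n) :
    ∃ (E : ℕ → Finset J) (b : ℕ → J → ℝ) (A' : lp (fun _ : ℕ => ℝ) p →L[ℝ] Y)
      (B' : Y →L[ℝ] lp (fun _ : ℕ => ℝ) p),
      (∀ k l, k ≠ l → Disjoint (E k) (E l)) ∧ (∀ k, (E k : Set J) ⊆ J') ∧
      (∀ a, B' (A' a) = a) ∧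
      ∀ a : lp (fun _ : ℕ => ℝ) p,
        HasSum (fun k => (a : ℕ → ℝ) k • ∑ j ∈ E k, b k j • x j) (A' a) := by
  classical
  have hr := r_ge hp
  have hK := h.K_nonneg
  obtain ⟨n, E, hn, hE, hEJ, hγ⟩ := block_select hp A B J' δ hδ hf
  have cx : ∀ k l, c k (x l) = if k = l then 1 else 0 := by
    intro k l
    split_ifs with hkl
    · rw [hkl]; exact h.bi_self l
    · exact h.bi_ne _ _ hkl
  let γ : ℕ → ℝ := fun k => ∑ j ∈ E k, c j (A (ee p (n k))) * (B (x j) : ℕ → ℝ) (n k)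
  have hγ' : ∀ k, 0 < γ k := fun k => lt_of_lt_of_le (by positivity) (hγ k)
  have hex : ∀ j, ∃ k, (∃ l, j ∈ E l) → j ∈ E k := by
    intro j
    by_cases hj : ∃ l, j ∈ E l
    · exact ⟨hj.choose, fun _ => hj.choose_spec⟩
    · exact ⟨0, fun hh => absurd hh hj⟩
  choose κ hκ using hex
  have hκ' : ∀ k, ∀ j ∈ E k, κ j = k := by
    intro k j hj
    by_contra hne
    exact Finset.disjoint_left.1 (hE _ _ hne) (hκ j ⟨k, hj⟩) hj
  let Q : ℕ → Y →L[ℝ] Y := fun k => ∑ j ∈ E k, (c j).smulRight (x j)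
  have hQ : ∀ k f, Q k f = ∑ j ∈ E k, c j f • x j := by
    intro k f; simp [Q]
  -- multiplier bound
  have hS : ∀ (F : Finset ℕ) (m : ℕ → ℝ) (M : ℝ), 0 ≤ M → (∀ k, |m k| ≤ M) → ∀ f,
      ‖∑ k ∈ F, m k • Q k f‖ ≤ M * K * ‖f‖ := by
    intro F m M hM hm f
    have := h.bd (F.biUnion E) (fun j => m (κ j)) M hM (fun j _ => hm _) f
    rw [Finset.sum_biUnion (fun k _ l _ hkl => hE k l hkl)] at this
    convert this using 2
    refine Finset.sum_congr rfl fun k _ => ?_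
    rw [hQ, Finset.smul_sum]
    refine Finset.sum_congr rfl fun j hj => ?_
    rw [smul_smul, hκ' k j hj]
  obtain ⟨A', hA'⟩ := L1 hp (fun k => (γ k)⁻¹ • Q k (A (ee p (n k)))) (2 / δ * K * ‖A‖)
    (by positivity) (by
      intro F
      refine ⟨F, subset_rfl, fun a => ?_⟩
      have e1 : ∑ k ∈ F, a k • (γ k)⁻¹ • Q k (A (ee p (n k))) =
          av F (fun t => ∑ k ∈ F, (sg t k * (γ k)⁻¹) •
            Q k (A (∑ l ∈ F, (sg t l * a l) • ee p (n l)))) := by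
        have := av_diag F (fun k l => (γ k)⁻¹ • a l • Q k (A (ee p (n l))))
        calc _ = ∑ k ∈ F, (γ k)⁻¹ • a k • Q k (A (ee p (n k))) :=
              Finset.sum_congr rfl fun k _ => smul_comm _ _ _
          _ = _ := by
              rw [← this]
              refine av_congr _ fun t _ => ?_
              refine Finset.sum_congr rfl fun k _ => ?_
              rw [mul_smul]
              congr 1
              simp only [map_sum, Finset.smul_sum, map_smul]
              refine Finset.sum_congr rfl fun l _ => ?_
              simp only [smul_smul]
              congr 1; ring
      rw [e1]
      refine (norm_av_le _ _).trans ?_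
      rw [← av_const F (2 / δ * K * ‖A‖ * (∑ i ∈ F, |a i| ^ p.toReal) ^ (1 / p.toReal))]
      refine av_mono _ fun t _ => ?_
      refine (hS F (fun k => sg t k * (γ k)⁻¹) (2 / δ) (by positivity) (fun k => ?_) _).trans ?_
      · rw [abs_mul, abs_sg, one_mul, abs_inv, abs_of_pos (hγ' k),
          inv_le_comm₀ (hγ' k) (by positivity), inv_div]
        exact hγ k
      · rw [mul_assoc (2 / δ * K)]
        gcongr
        refine (A.le_opNorm _).trans ?_
        gcongr
        rw [norm_sum_ee_inj hp _ _ _ hn]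
        simp [abs_mul, abs_sg])
  obtain ⟨B', hB'⟩ := L2 hp (fun k => ((evv p (n k)).comp B).comp (Q k)) (‖B‖ * K)
    (by positivity) (by
      intro f F
      refine ⟨F, subset_rfl, ?_⟩
      let S : Finset ℕ → Y := fun t => ∑ k ∈ F, sg t k • Q k f
      have e1 : ∀ k ∈ F, (((evv p (n k)).comp B).comp (Q k)) f =
          av F (fun t => sg t k * (B (S t) : ℕ → ℝ) (n k)) := by
        intro k hk
        have : ∀ t, sg t k * (B (S t) : ℕ → ℝ) (n k) =
            ∑ l ∈ F, (sg t k * sg t l) • evv p (n k) (B (Q l f)) := by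
          intro t
          rw [← evv_apply]
          simp only [S, map_sum, map_smul, Finset.mul_sum, smul_eq_mul, mul_assoc]
        simp only [this]
        rw [av_sum, Finset.sum_eq_single k]
        · simp only [sg_mul_self, one_smul]
          rw [av_const]; rfl
        · intro l hl hlk
          rw [av_smul_const, av_sg_sg F k l hk hlk.symm, zero_smul]
        · exact fun h => absurd hk h
      calc _ ≤ ∑ k ∈ F, av F (fun t => |(B (S t) : ℕ → ℝ) (n k)| ^ p.toReal) := by
            refine Finset.sum_le_sum fun k hk => ?_
            rw [e1 k hk]
            refine le_trans ?_ (av_rpow_le F _ (fun t => abs_nonneg _) _ hr)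
            refine Real.rpow_le_rpow (abs_nonneg _) ?_ (by linarith)
            refine (norm_av_le (E := ℝ) F _).trans (av_mono _ fun t _ => ?_)
            rw [Real.norm_eq_abs, abs_mul, abs_sg, one_mul]
        _ = av F (fun t => ∑ k ∈ F, |(B (S t) : ℕ → ℝ) (n k)| ^ p.toReal) := by rw [av_sum]
        _ ≤ av F (fun _ => (‖B‖ * K * ‖f‖) ^ p.toReal) := by
            refine av_mono _ fun t _ => (sum_le_norm_inj hp _ _ _ hn.injOn).trans ?_
            refine Real.rpow_le_rpow (norm_nonneg _) ?_ (by linarith)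
            refine (B.le_opNorm _).trans ?_
            rw [mul_assoc]
            gcongr
            have := hS F (fun k => sg t k) 1 zero_le_one (fun k => (abs_sg t k).le) f
            simpa using this
        _ = _ := av_const _ _)
  refine ⟨E, fun k j => (γ k)⁻¹ * c j (A (ee p (n k))), A', B', hE, hEJ, fun a => ?_, fun a => ?_⟩
  · ext l
    rw [hB']
    have h1 := (hA' a).mapL (((evv p (n l)).comp B).comp (Q l))
    refine h1.unique ?_
    have h2 : ∀ k, Q l (Q k (A (ee p (n k)))) = if k = l then Q l (A (ee p (n l))) else 0 := by
      intro k
      rw [hQ l, hQ k]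
      simp only [map_sum, map_smul, cx, smul_eq_mul, mul_ite, mul_one, mul_zero]
      split_ifs with hkl
      · subst hkl
        rw [hQ]
        refine Finset.sum_congr rfl fun j hj => ?_
        simp [hj]
      · refine Finset.sum_eq_zero fun j hj => ?_
        have : j ∉ E k := Finset.disjoint_right.1 (hE k l hkl) hj
        simp [this]
    convert hasSum_single l ?_ using 1
    · simp only [map_smul, ContinuousLinearMap.comp_apply, h2, if_true]
      have : evv p (n l) (B (Q l (A (ee p (n l))))) = γ l := by
        rw [hQ]; simp [γ, evv_apply, map_sum]
      rw [this]
      have := (hγ' l).ne'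
      simp [this]
    · intro k hk
      simp only [map_smul, ContinuousLinearMap.comp_apply, h2, hk, if_false, map_zero, smul_zero]
  · convert hA' a using 2 with k
    rw [hQ]
    simp only [mul_smul, Finset.smul_sum]

lemma lp_exp_cmp {s t C : ℝ} (h : ∀ N : ℕ, (N : ℝ) ^ s ≤ C * (N : ℝ) ^ t) : s ≤ t := by
  by_contra hlt
  push Not at hlt
  have h1 : Filter.Tendsto (fun N : ℕ => (N : ℝ) ^ (s - t)) Filter.atTop Filter.atTop :=
    (tendsto_rpow_atTop (by linarith)).comp tendsto_natCast_atTop_atTop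
  obtain ⟨N, hN, hN1⟩ := ((h1.eventually_gt_atTop C).and (Filter.eventually_gt_atTop 0)).exists
  have hN0 : (0 : ℝ) < N := by exact_mod_cast hN1
  rw [Real.rpow_sub hN0, lt_div_iff₀ (Real.rpow_pos_of_pos hN0 _)] at hN
  linarith [h N]

lemma exists_half {x : J → Y} {c : J → Y →L[ℝ] ℝ} {K : ℝ} (h : UB x c K)
    (I : lp (fun _ : ℕ => ℝ) p →L[ℝ] Y) (P : Y →L[ℝ] lp (fun _ : ℕ => ℝ) p)
    (hPI : ∀ a, P (I a) = a) (n : ℕ) :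
    ∃ F : Finset J, 1 / 2 ≤ ∑ j ∈ F, c j (I (ee p n)) * (P (x j) : ℕ → ℝ) n := by
  have := w_summable h I P n
  rw [hPI, ee_self] at this
  obtain ⟨F, hF⟩ := (this.eventually (lt_mem_nhds (show (1 / 2 : ℝ) < 1 by norm_num))).exists
  exact ⟨F, hF.le⟩

set_option maxHeartbeats 2000000 in
theorem F3 {q : ℝ≥0∞} [Fact (1 ≤ q)] (hp : p ≠ ⊤) (hq : q ≠ ⊤)
    (hF : Fac (lp (fun _ : ℕ => ℝ) p) (lp (fun _ : ℕ => ℝ) q)) : p = q := by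
  classical
  have hr := r_ge hp
  have hs := r_ge hq
  obtain ⟨A, B, hBA⟩ := hF
  have hU := UB_ee (ι := ℕ) hq
  obtain ⟨E, b, A', B', hE, -, hBA', hA'⟩ := block hU hp A B Set.univ (1 / 2) (by norm_num) (by
    refine Filter.Eventually.frequently (Filter.Eventually.of_forall fun n => ?_)
    obtain ⟨F, hF⟩ := exists_half hU A B hBA n
    exact ⟨F, Set.subset_univ _, hF⟩)
  let u : ℕ → lp (fun _ : ℕ => ℝ) q := fun k => ∑ j ∈ E k, b k j • ee q j
  have hu : ∀ k, A' (ee p k) = u k := by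
    intro k
    refine (hA' (ee p k)).unique ?_
    convert hasSum_single k ?_ using 1
    · rw [ee_self, one_smul]
    · intro l hl
      rw [ee_ne _ _ hl, zero_smul]
  have hn : ∀ N : ℕ, ‖∑ k ∈ Finset.range N, u k‖ =
      (∑ k ∈ Finset.range N, ‖u k‖ ^ q.toReal) ^ (1 / q.toReal) := by
    intro N
    have hex : ∀ j, ∃ k, (∃ l, j ∈ E l) → j ∈ E k := by
      intro j
      by_cases hj : ∃ l, j ∈ E l
      · exact ⟨hj.choose, fun _ => hj.choose_spec⟩
      · exact ⟨0, fun hh => absurd hh hj⟩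
    choose κ hκ using hex
    have hκ' : ∀ k, ∀ j ∈ E k, κ j = k := by
      intro k j hj
      by_contra hne
      exact Finset.disjoint_left.1 (hE _ _ hne) (hκ j ⟨k, hj⟩) hj
    have e1 : ∑ k ∈ Finset.range N, u k =
        ∑ j ∈ (Finset.range N).biUnion E, b (κ j) j • ee q j := by
      rw [Finset.sum_biUnion (fun k _ l _ hkl => hE k l hkl)]
      refine Finset.sum_congr rfl fun k _ => Finset.sum_congr rfl fun j hj => ?_
      rw [hκ' k j hj]
    rw [e1, norm_sum_ee hq, Finset.sum_biUnion (fun k _ l _ hkl => hE k l hkl)]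
    congr 1
    refine Finset.sum_congr rfl fun k _ => ?_
    simp only [u]
    rw [norm_sum_ee hq, ← Real.rpow_mul (by positivity), one_div_mul_cancel (by linarith),
      Real.rpow_one]
    refine Finset.sum_congr rfl fun j hj => ?_
    rw [hκ' k j hj]
  have hm : ∀ N : ℕ, ‖∑ k ∈ Finset.range N, ee p k‖ = (N : ℝ) ^ (1 / p.toReal) := by
    intro N
    have := norm_sum_ee hp (fun _ => (1 : ℝ)) (Finset.range N)
    simpa using this
  have hsum : ∀ N : ℕ, A' (∑ k ∈ Finset.range N, ee p k) = ∑ k ∈ Finset.range N, u k := by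
    intro N; rw [map_sum]; exact Finset.sum_congr rfl fun k _ => hu k
  have hpow : ∀ (D : ℝ), 0 ≤ D → ∀ N : ℕ, (∑ k ∈ Finset.range N, D ^ q.toReal) ^ (1 / q.toReal) =
      D * (N : ℝ) ^ (1 / q.toReal) := by
    intro D hD N
    rw [Finset.sum_const, Finset.card_range, nsmul_eq_mul, Real.mul_rpow (by positivity)
      (by positivity), ← Real.rpow_mul hD, mul_one_div_cancel (by linarith), Real.rpow_one, mul_comm]
  have hub : ∀ k, ‖u k‖ ≤ ‖A'‖ := by
    intro k; rw [← hu]; simpa [norm_ee hp] using A'.le_opNorm (ee p k)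
  have hlb : ∀ k, 1 ≤ ‖B'‖ * ‖u k‖ := by
    intro k; rw [← hu]
    have := B'.le_opNorm (A' (ee p k))
    rwa [hBA', norm_ee hp] at this
  clear_value u
  have i1 : 1 / p.toReal ≤ 1 / q.toReal := by
    refine lp_exp_cmp (C := ‖B'‖ * ‖A'‖) fun N => ?_
    rw [← hm]
    have := B'.le_opNorm (A' (∑ k ∈ Finset.range N, ee p k))
    rw [hBA', hsum, hn] at this
    refine this.trans ?_
    rw [mul_assoc]
    gcongr
    rw [← hpow _ (norm_nonneg _)]
    gcongr with k
    exact hub k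
  have i2 : 1 / q.toReal ≤ 1 / p.toReal := by
    refine lp_exp_cmp (C := ‖B'‖ * ‖A'‖) fun N => ?_
    rw [← hm, mul_assoc]
    refine le_trans ?_ (mul_le_mul_of_nonneg_left (A'.le_opNorm _) (norm_nonneg B'))
    rw [hsum, hn]
    have hB0 : 0 < ‖B'‖ := by
      rcases (norm_nonneg B').eq_or_lt with h0 | h0
      · have := hlb 0; rw [← h0] at this; norm_num at this
      · exact h0
    have e := hpow ‖B'‖⁻¹ (by positivity) N
    have : ‖B'‖⁻¹ * (N : ℝ) ^ (1 / q.toReal) ≤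
        (∑ k ∈ Finset.range N, ‖u k‖ ^ q.toReal) ^ (1 / q.toReal) := by
      rw [← e]
      gcongr with k
      rw [inv_le_iff_one_le_mul₀' hB0]
      exact hlb k
    rwa [inv_mul_le_iff₀ hB0] at this
  have := le_antisymm i1 i2
  rw [one_div, one_div, inv_inj] at this
  exact (ENNReal.toReal_eq_toReal_iff' hp hq).1 this
end
end

section
section
variable {p : ℝ≥0∞} [hp1 : Fact (1 ≤ p)] {J Y : Type*} [NormedAddCommGroup Y] [NormedSpace ℝ Y]

theorem F2 [CompleteSpace Y] {x : J → Y} {c : J → Y →L[ℝ] ℝ} {K : ℝ} (h : UB x c K)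
    (hp : p ≠ ⊤) (I : lp (fun _ : ℕ => ℝ) p →L[ℝ] Y) (P : Y →L[ℝ] lp (fun _ : ℕ => ℝ) p)
    (hPI : ∀ a, P (I a) = a) {A : Type*} [Fintype A] (π : J → A) :
    ∃ q : A, Fac (lp (fun _ : ℕ => ℝ) p)
      (Submodule.span ℝ (x '' (π ⁻¹' {q}))).topologicalClosure := by
  classical
  let δ : ℝ := 1 / (2 * (Fintype.card A + 1))
  have hδ : 0 < δ := by positivity
  have hq : ∃ q : A, ∃ᶠ n in Filter.atTop, ∃ F : Finset J, (F : Set J) ⊆ π ⁻¹' {q} ∧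
      δ ≤ ∑ j ∈ F, c j (I (ee p n)) * (P (x j) : ℕ → ℝ) n := by
    by_contra hcon
    simp only [not_exists, Filter.not_frequently] at hcon
    have := Filter.eventually_all.2 hcon
    obtain ⟨n, hn⟩ := this.exists
    obtain ⟨F, hF⟩ := exists_half h I P hPI n
    rw [← Finset.sum_fiberwise F π] at hF
    have h1 : ∀ q : A, ∑ j ∈ F with π j = q, c j (I (ee p n)) * (P (x j) : ℕ → ℝ) n ≤ δ := by
      intro q
      by_contra hlt
      push Not at hlt
      exact hn q (F.filter (fun j => π j = q)) ⟨fun j hj => by simpa using (Finset.mem_filter.1 hj).2, hlt.le⟩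
    have h2 := hF.trans (Finset.sum_le_sum fun q _ => h1 q)
    rw [Finset.sum_const, Finset.card_univ, nsmul_eq_mul] at h2
    have h3 : (Fintype.card A : ℝ) * δ < 1 / 2 := by
      simp only [δ]
      rw [mul_one_div, div_lt_div_iff₀ (by positivity) (by norm_num)]
      linarith
    linarith
  obtain ⟨q, hq⟩ := hq
  refine ⟨q, ?_⟩
  obtain ⟨E, b, A', B', -, hEJ, hBA', hA'⟩ := block h hp I P _ δ hδ hq
  refine ⟨A'.codRestrict _ fun a => ?_, B'.comp (Submodule.subtypeL _), fun a => by simp [hBA']⟩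
  refine mem_closed_of_hasSum _ (Submodule.isClosed_topologicalClosure _) (fun k => ?_) (hA' a)
  refine Submodule.smul_mem _ _ (Submodule.sum_mem _ fun j hj => Submodule.smul_mem _ _ ?_)
  exact Submodule.le_topologicalClosure _ (Submodule.subset_span ⟨j, hEJ k hj, rfl⟩)
end
end

section
section
variable {p : ℝ≥0∞} [hp1 : Fact (1 ≤ p)]

open Classical in
lemma reindex {ι κ : Type*} (hp : p ≠ ⊤) (s : Set ι) (e : ι → κ) (he : Set.InjOn e s) :
    ∃ T : lp (fun _ : κ => ℝ) p →L[ℝ] lp (fun _ : ι => ℝ) p,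
      ∀ f i, (T f : ι → ℝ) i = if i ∈ s then (f : κ → ℝ) (e i) else 0 := by
  have hr := r_ge hp
  obtain ⟨T, hT⟩ := L2 hp (fun i : ι => if i ∈ s then evv p (e i) else 0) 1 zero_le_one (by
    intro f F
    refine ⟨F, subset_rfl, ?_⟩
    rw [one_mul]
    refine le_trans (le_of_eq ?_) (sum_le_norm_inj hp f (F.filter (fun i => i ∈ s)) e
      (he.mono fun i hi => (Finset.mem_filter.1 hi).2))
    rw [Finset.sum_filter]
    refine Finset.sum_congr rfl fun i _ => ?_
    split_ifs with h
    · rfl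
    · simp only [ContinuousLinearMap.zero_apply, abs_zero]
      exact Real.zero_rpow (by linarith))
  refine ⟨T, fun f i => ?_⟩
  rw [hT]
  split_ifs <;> rfl

abbrev WW (p : ℝ≥0∞) := lp (fun _ : ℕ × ℕ => ℝ) p
abbrev LL (p : ℝ≥0∞) := lp (fun _ : ℕ => ℝ) p

lemma WW_equiv (hp : p ≠ ⊤) : Nonempty (WW p ≃L[ℝ] LL p) := by
  classical
  let e : ℕ × ℕ ≃ ℕ := Nat.pairEquiv
  obtain ⟨T, hT⟩ := reindex hp Set.univ e e.injective.injOn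
  obtain ⟨T', hT'⟩ := reindex hp Set.univ e.symm e.symm.injective.injOn
  refine ⟨ContinuousLinearEquiv.equivOfInverse T' T (fun f => ?_) (fun f => ?_)⟩
  · ext i; simp [hT, hT']
  · ext i; simp [hT, hT']

lemma exists_R (hp : p ≠ ⊤) : ∃ R : ℕ → WW p →L[ℝ] LL p,
    (∀ m f n, (R m f : ℕ → ℝ) n = (f : ℕ × ℕ → ℝ) (m, n)) ∧
    ∀ f (F : Finset ℕ), ∑ m ∈ F, ‖R m f‖ ^ p.toReal ≤ ‖f‖ ^ p.toReal := by
  classical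
  have hr := r_ge hp
  have : ∀ m : ℕ, ∃ R : WW p →L[ℝ] LL p, ∀ f n, (R f : ℕ → ℝ) n = (f : ℕ × ℕ → ℝ) (m, n) := by
    intro m
    obtain ⟨T, hT⟩ := reindex hp Set.univ (fun n : ℕ => (m, n))
      (fun a _ b _ h => (Prod.mk.inj h).2)
    exact ⟨T, fun f n => by simp [hT]⟩
  choose R hR using this
  refine ⟨R, hR, fun f F => ?_⟩
  have h1 : HasSum (fun n => ∑ m ∈ F, ‖(R m f : ℕ → ℝ) n‖ ^ p.toReal)
      (∑ m ∈ F, ‖R m f‖ ^ p.toReal) :=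
    hasSum_sum fun m _ => lp.hasSum_norm (by linarith) (R m f)
  refine hasSum_le_of_sum_le h1 fun G => ?_
  have h2 := sum_le_norm hp f (F ×ˢ G)
  rw [Finset.sum_product_right] at h2
  refine le_trans (le_of_eq ?_) h2
  refine Finset.sum_congr rfl fun n _ => Finset.sum_congr rfl fun m _ => ?_
  rw [hR, Real.norm_eq_abs]

lemma exists_tilde (hp : p ≠ ⊤) (R : ℕ → WW p →L[ℝ] LL p)
    (hR : ∀ m f n, (R m f : ℕ → ℝ) n = (f : ℕ × ℕ → ℝ) (m, n))
    (hR' : ∀ f (F : Finset ℕ), ∑ m ∈ F, ‖R m f‖ ^ p.toReal ≤ ‖f‖ ^ p.toReal)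
    (T : LL p →L[ℝ] LL p) : ∃ T' : WW p →L[ℝ] WW p, ∀ m f, R m (T' f) = T (R m f) := by
  classical
  have hr := r_ge hp
  obtain ⟨T', hT'⟩ := L2 hp (fun i : ℕ × ℕ => (evv p i.2).comp (T.comp (R i.1))) ‖T‖
    (norm_nonneg _) (by
    intro f F
    refine ⟨F.image Prod.fst ×ˢ F.image Prod.snd, Finset.subset_product, ?_⟩
    rw [Finset.sum_product]
    calc _ ≤ ∑ m ∈ F.image Prod.fst, ‖T‖ ^ p.toReal * ‖R m f‖ ^ p.toReal := by
          refine Finset.sum_le_sum fun m _ => ?_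
          refine (sum_le_norm hp (T (R m f)) _).trans ?_
          rw [← Real.mul_rpow (norm_nonneg _) (norm_nonneg _)]
          exact Real.rpow_le_rpow (norm_nonneg _) (T.le_opNorm _) (by linarith)
      _ ≤ _ := by
          rw [← Finset.mul_sum, Real.mul_rpow (norm_nonneg _) (norm_nonneg _)]
          gcongr
          exact hR' f _)
  refine ⟨T', fun m f => ?_⟩
  ext n
  rw [hR, hT']
  rfl

lemma absorb (hp : p ≠ ⊤) {X : Type*} [NormedAddCommGroup X] [NormedSpace ℝ X]
    (h : Fac X (LL p)) : Nonempty ((X × WW p) ≃L[ℝ] WW p) := by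
  classical
  obtain ⟨A, B, hBA⟩ := h
  obtain ⟨R, hR, hR'⟩ := exists_R hp
  obtain ⟨P, hP⟩ := exists_tilde hp R hR hR' (A.comp B)
  have hext : ∀ f g : WW p, (∀ m, R m f = R m g) → f = g := by
    intro f g hfg
    ext ⟨m, n⟩
    rw [← hR, ← hR, hfg]
  obtain ⟨S, hS⟩ := reindex hp {i : ℕ × ℕ | i.1 ≠ 0} (fun i => (i.1 - 1, i.2)) (by
    rintro ⟨a, b⟩ ha ⟨a', b'⟩ ha' hh
    simp only [Set.mem_setOf_eq, ne_eq, Prod.mk.injEq] at *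
    omega)
  obtain ⟨S', hS'⟩ := reindex hp Set.univ (fun i : ℕ × ℕ => (i.1 + 1, i.2)) (by
    rintro ⟨a, b⟩ ha ⟨a', b'⟩ ha' hh
    simp only [Prod.mk.injEq] at *
    omega)
  obtain ⟨I, hI⟩ := reindex hp {i : ℕ × ℕ | i.1 = 0} (fun i => i.2) (by
    rintro ⟨a, b⟩ ha ⟨a', b'⟩ ha' hh
    simp only [Set.mem_setOf_eq, Prod.mk.injEq] at *
    omega)
  have S0 : ∀ f, R 0 (S f) = 0 := by
    intro f; ext n; rw [hR, hS]; simp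
  have S1 : ∀ m f, R (m + 1) (S f) = R m f := by
    intro m f; ext n; rw [hR, hS, hR]; simp
  have S2 : ∀ m f, R m (S' f) = R (m + 1) f := by
    intro m f; ext n; rw [hR, hS', hR]; simp
  have I0 : ∀ f, R 0 (I f) = f := by
    intro f; ext n; rw [hR, hI]; simp
  have I1 : ∀ m f, R (m + 1) (I f) = 0 := by
    intro m f; ext n; rw [hR, hI]; simp
  let fw : (X × WW p) →L[ℝ] WW p :=
    (I.comp A).coprod (S.comp P + (ContinuousLinearMap.id ℝ _ - P))
  let bw : WW p →L[ℝ] (X × WW p) :=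
    (B.comp (R 0)).prod (S'.comp P + (ContinuousLinearMap.id ℝ _ - P))
  have hfw : ∀ y f, fw (y, f) = I (A y) + (S (P f) + (f - P f)) := fun y f => rfl
  have hbw : ∀ f, bw f = (B (R 0 f), S' (P f) + (f - P f)) := fun f => rfl
  refine ⟨ContinuousLinearEquiv.equivOfInverse fw bw ?_ ?_⟩
  · rintro ⟨y, f⟩
    rw [hbw, hfw]
    refine Prod.ext ?_ (hext _ _ fun m => ?_)
    · simp only [map_add, map_sub, I0, S0, hP, ContinuousLinearMap.comp_apply, hBA]
      simp
    · cases m with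
      | zero =>
        simp only [map_add, map_sub, I0, S0, I1, S1, S2, hP, ContinuousLinearMap.comp_apply, hBA,
          map_zero, zero_add]
        abel
      | succ m =>
        simp only [map_add, map_sub, I0, S0, I1, S1, S2, hP, ContinuousLinearMap.comp_apply, hBA,
          map_zero, zero_add]
        abel
  · intro f
    rw [hbw, hfw]
    refine hext _ _ fun m => ?_
    cases m with
    | zero =>
      simp only [map_add, map_sub, I0, S0, I1, S1, S2, hP, ContinuousLinearMap.comp_apply, hBA,
          map_zero, zero_add]
      abel
    | succ m =>
      simp only [map_add, map_sub, I0, S0, I1, S1, S2, hP, ContinuousLinearMap.comp_apply, hBA,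
          map_zero, zero_add]
      abel

theorem F4 (hp : p ≠ ⊤) {X : Type*} [NormedAddCommGroup X] [NormedSpace ℝ X]
    (h : Fac X (LL p)) (h' : Fac (LL p) X) : Nonempty (X ≃L[ℝ] LL p) := by
  obtain ⟨w⟩ := WW_equiv hp
  obtain ⟨e1⟩ := absorb hp h
  obtain ⟨e2⟩ := absorb hp (X := LL p) ⟨ContinuousLinearMap.id ℝ _, ContinuousLinearMap.id ℝ _,
    fun _ => rfl⟩
  let eX : (X × LL p) ≃L[ℝ] LL p :=
    ((ContinuousLinearEquiv.refl ℝ X).prodCongr w.symm).trans (e1.trans w)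
  let eL : (LL p × LL p) ≃L[ℝ] LL p :=
    ((ContinuousLinearEquiv.refl ℝ (LL p)).prodCongr w.symm).trans (e2.trans w)
  obtain ⟨A, B, hBA⟩ := h'
  let d := ContinuousLinearEquiv.equivOfRightInverse B A hBA
  exact ⟨d.trans <| (eL.symm.prodCongr (ContinuousLinearEquiv.refl ℝ _)).trans <|
    (ContinuousLinearEquiv.prodAssoc ℝ _ _ _).trans <|
    ((ContinuousLinearEquiv.refl ℝ _).prodCongr d.symm).trans <|
    (ContinuousLinearEquiv.prodComm ℝ _ _).trans eX⟩
end
end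

section
theorem abs_main {A J Z : Type*} [Fintype A] [NormedAddCommGroup Z] [NormedSpace ℝ Z]
    [CompleteSpace Z] (p : A → ℝ≥0∞) [∀ a, Fact (1 ≤ p a)] (hp : ∀ a, p a ≠ ⊤)
    (hinj : Function.Injective p) (x : J → Z)
    (hx : ∀ f : Z, ∃! a : J → ℝ, HasSum (fun j => a j • x j) f)
    (I : ∀ a, LL (p a) →L[ℝ] Z) (P : ∀ a, Z →L[ℝ] LL (p a)) (hPI : ∀ a f, P a (I a f) = f)
    (hIP : ∀ z, ∑ a, I a (P a z) = z) :
    ∃ π : J → A, ∀ a, Nonempty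
      ((Submodule.span ℝ (x '' (π ⁻¹' {a}))).topologicalClosure ≃L[ℝ] LL (p a)) := by
  classical
  obtain ⟨c, K, h⟩ := exists_UB x hx
  let δ : ℝ := 1 / (Fintype.card A + 1)
  have hδ : 0 < δ := by positivity
  have hex : ∀ j, ∃ a, δ ≤ c j (I a (P a (x j))) := by
    intro j
    by_contra hcon
    push Not at hcon
    have h1 : ∑ a, c j (I a (P a (x j))) = 1 := by
      rw [← map_sum, hIP, h.bi_self]
    have h2 := Finset.sum_le_sum (s := Finset.univ) fun a _ => (hcon a).le
    rw [h1, Finset.sum_const, Finset.card_univ, nsmul_eq_mul] at h2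
    have h3 : (Fintype.card A : ℝ) * δ < 1 := by
      simp only [δ]
      rw [mul_one_div, div_lt_one (by positivity)]
      linarith
    linarith
  choose π hπ using hex
  have hF1 : ∀ a, Fac (Submodule.span ℝ (x '' (π ⁻¹' {a}))).topologicalClosure (LL (p a)) := by
    intro a
    refine F1 h (hp a) (I a) (P a) _ δ hδ fun j hj => ?_
    have : π j = a := hj
    rw [← this]
    exact hπ j
  refine ⟨π, fun a => ?_⟩
  obtain ⟨q, hq⟩ := F2 h (hp a) (I a) (P a) (hPI a) π
  have := hinj (F3 (hp a) (hp q) (hq.trans (hF1 q)))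
  subst this
  exact F4 (hp a) (hF1 a) hq
end

/-- If `A ⊆ [1,∞)` is a finite set of exponents and `(x_j)_{j ∈ J}` is an
unconditional basis of `Z = ⨁_{p ∈ A} ℓ_p` (with the sup norm on the direct sum), then `J`
splits into a partition `(J_p)_{p ∈ A}` such that for each `p ∈ A` the closed linear span of
`{x_j : j ∈ J_p}` is isomorphic, as a topological vector space, to `ℓ_p`. -/
theorem unconditional_basis_of_direct_sum_lp_splits
    (A : Finset {q : ℝ // 1 ≤ q}) {J : Type}
    (x : J → PiLp ⊤ (fun p : A => ellp p.1.1))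
    (hx : ∀ f : PiLp ⊤ (fun p : A => ellp p.1.1),
      ∃! a : J → ℝ, HasSum (fun j => a j • x j) f) :
    ∃ Jp : A → Set J,
      (Pairwise fun p q => Disjoint (Jp p) (Jp q)) ∧
      (⋃ p, Jp p) = Set.univ ∧
      ∀ p : A,
        Nonempty (((Submodule.span ℝ (x '' Jp p)).topologicalClosure) ≃L[ℝ] ellp p.1.1) := by
  classical
  have hfact : ∀ p : A, Fact ((1 : ℝ≥0∞) ≤ ENNReal.ofReal p.1.1) := fun p => inferInstance
  obtain ⟨π, hπ⟩ := abs_main (fun p : A => ENNReal.ofReal p.1.1) (fun p => ENNReal.ofReal_ne_top)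
    (by
      intro p q hpq
      have h1 := p.1.2
      have h2 := q.1.2
      have h3 := (ENNReal.ofReal_eq_ofReal_iff (by linarith) (by linarith)).1 hpq
      exact Subtype.ext (Subtype.ext h3)) x hx
    (fun p => (PiLp.continuousLinearEquiv ⊤ ℝ (fun p : A => ellp p.1.1)).symm.toContinuousLinearMap.comp
      (ContinuousLinearMap.single ℝ (fun p : A => ellp p.1.1) p))
    (fun p => PiLp.proj ⊤ (fun p : A => ellp p.1.1) p)
    (fun p f => by simp)
    (fun z => by
      ext1 p
      simp [Pi.single_apply])
  refine ⟨fun p => π ⁻¹' {p}, ?_, ?_, hπ⟩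
  · intro p q hpq
    refine Set.disjoint_left.2 fun j hj hj' => hpq ?_
    have h1 : π j = p := hj
    have h2 : π j = q := hj'
    rw [← h1, h2]
  · ext j
    simp


end
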